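/- Let ρ, σ ∈ M_n(ℂ) be positive semidefinite with supp ρ ⊆ supp σ, and let Φ : M_n(ℂ) → M_m(ℂ) be a 2-positive trace-preserving linear map. Then Tr( ( Φ(σ)^{−1/4} Φ(ρ) Φ(σ)^{−1/4} )² ) = Tr( ( σ^{−1/4} ρ σ^{−1/4} )² ) if and only if Φ_σ*(Φ(ρ)) = ρ, where the negative powers are taken in the Moore–Penrose sense. (Equivalently: the sandwiched Rényi divergence D_2* is preserved by Φ if and only if the Petz recovery map recovers ρ from Φ(ρ).) -/

import Mathlib

open Matrix
open scoped ComplexOrder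

/-- Moore–Penrose power of a matrix: apply `x ↦ x ^ t` to the nonzero eigenvalues
(with `0 ^ t := 0`) via the continuous functional calculus; for `t < 0` this is the
corresponding power of the Moore–Penrose inverse. -/
noncomputable def mpow {n : ℕ} (A : Matrix (Fin n) (Fin n) ℂ) (t : ℝ) :
    Matrix (Fin n) (Fin n) ℂ :=
  cfc (fun x : ℝ => if x = 0 then 0 else x ^ t) A

/-- The adjoint of a linear map between matrix spaces with respect to the
Hilbert–Schmidt inner product `⟨A, B⟩ = Tr(Aᴴ B)`. -/
noncomputable def adjointMap {n m : ℕ}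
    (Φ : Matrix (Fin n) (Fin n) ℂ →ₗ[ℂ] Matrix (Fin m) (Fin m) ℂ) :
    Matrix (Fin m) (Fin m) ℂ → Matrix (Fin n) (Fin n) ℂ :=
  fun Y => Matrix.of fun i j => Matrix.trace ((Φ (Matrix.single i j 1))ᴴ * Y)

/-- The Petz recovery map `Φ_σ*(Y) = σ^{1/2} Φ*(Φ(σ)^{-1/2} Y Φ(σ)^{-1/2}) σ^{1/2}`. -/
noncomputable def petzMap {n m : ℕ}
    (Φ : Matrix (Fin n) (Fin n) ℂ →ₗ[ℂ] Matrix (Fin m) (Fin m) ℂ)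
    (σ : Matrix (Fin n) (Fin n) ℂ) (Y : Matrix (Fin m) (Fin m) ℂ) :
    Matrix (Fin n) (Fin n) ℂ :=
  mpow σ (1/2) *
    adjointMap Φ (mpow (Φ σ) (-(1/2)) * Y * mpow (Φ σ) (-(1/2))) * mpow σ (1/2)

/-- `Φ` is 2-positive: it maps positive semidefinite `2×2`-block matrices (blockwise)
to positive semidefinite block matrices. -/
def Is2Positive {n m : ℕ}
    (Φ : Matrix (Fin n) (Fin n) ℂ →ₗ[ℂ] Matrix (Fin m) (Fin m) ℂ) : Prop :=
  ∀ A B C D : Matrix (Fin n) (Fin n) ℂ,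
    (Matrix.fromBlocks A B C D).PosSemidef →
    (Matrix.fromBlocks (Φ A) (Φ B) (Φ C) (Φ D)).PosSemidef

section mpow

variable {n : ℕ} {A Y : Matrix (Fin n) (Fin n) ℂ}

open scoped MatrixOrder in
lemma mpow_posSemidef (hA : A.PosSemidef) (t : ℝ) : (mpow A t).PosSemidef := by
  rw [← nonneg_iff_posSemidef]
  refine cfc_nonneg fun x hx => ?_
  have : 0 ≤ x := spectrum_nonneg_of_nonneg hA.nonneg hx
  split_ifs <;> positivity

lemma mpow_isHermitian (hA : A.PosSemidef) (t : ℝ) : (mpow A t)ᴴ = mpow A t :=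
  (mpow_posSemidef hA t).isHermitian

open scoped MatrixOrder in
lemma mpow_mul_mpow (hA : A.PosSemidef) (s t : ℝ) : mpow A s * mpow A t = mpow A (s + t) := by
  have hc (f : ℝ → ℝ) : ContinuousOn f (spectrum ℝ A) := A.finite_real_spectrum.continuousOn f
  rw [mpow, mpow, mpow, ← cfc_mul _ _ A (hc _) (hc _)]
  refine cfc_congr fun x hx => ?_
  have hx0 : 0 ≤ x := spectrum_nonneg_of_nonneg hA.nonneg hx
  by_cases h : x = 0
  · simp [h]
  · simp [h, Real.rpow_add (lt_of_le_of_ne hx0 (Ne.symm h))]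

lemma mpow_one (hA : A.PosSemidef) : mpow A 1 = A := by
  have : IsSelfAdjoint A := hA.isHermitian
  rw [mpow]
  conv_rhs => rw [← cfc_id ℝ A]
  refine cfc_congr fun x _ => ?_
  by_cases h : x = 0 <;> simp [h]

open scoped MatrixOrder in
lemma one_sub_mpow_zero_posSemidef (A : Matrix (Fin n) (Fin n) ℂ) :
    (1 - mpow A 0).PosSemidef := by
  rw [← Matrix.le_iff]
  refine cfc_le_one _ _ fun x _ => ?_
  split_ifs <;> simp

lemma mul_mpow_zero (hA : A.PosSemidef) (hY : ∀ v : Fin n → ℂ, A *ᵥ v = 0 → Y *ᵥ v = 0) :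
    Y * mpow A 0 = Y := by
  have h : A * (1 - mpow A 0) = 0 := by
    have := mpow_mul_mpow hA 1 0
    rw [add_zero, mpow_one hA] at this
    rw [mul_sub, this, mul_one, sub_self]
  have h' : Y * (1 - mpow A 0) = 0 := by
    refine ext_of_mulVec_single fun i => ?_
    rw [← mulVec_mulVec, zero_mulVec]
    apply hY
    rw [mulVec_mulVec, h, zero_mulVec]
  rw [mul_sub, mul_one, sub_eq_zero] at h'
  exact h'.symm

lemma mpow_zero_mul (hA : A.PosSemidef) (hY' : Y.IsHermitian) (hY : Y * mpow A 0 = Y) :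
    mpow A 0 * Y = Y := by
  simpa [conjTranspose_mul, mpow_isHermitian hA, hY'.eq] using congrArg conjTranspose hY

end mpow

section PosSemidef

variable {ι : Type*} [Fintype ι] {A B : Matrix ι ι ℂ}

open scoped MatrixOrder in
lemma Matrix.PosSemidef.trace_mul_nonneg [DecidableEq ι] (hA : A.PosSemidef) (hB : B.PosSemidef) :
    0 ≤ (A * B).trace := by
  obtain ⟨K, rfl⟩ := CStarAlgebra.nonneg_iff_eq_star_mul_self.mp hA.nonneg
  rw [mul_assoc, trace_mul_comm, star_eq_conjTranspose]
  exact (hB.mul_mul_conjTranspose_same K).trace_nonneg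

open scoped MatrixOrder in
lemma Matrix.PosSemidef.exists_smul_one_sub [DecidableEq ι] (hA : A.PosSemidef) :
    ∃ c : ℝ, 0 ≤ c ∧ (c • (1 : Matrix ι ι ℂ) - A).PosSemidef := by
  obtain ⟨c, hc⟩ := A.finite_real_spectrum.bddAbove
  refine ⟨max c 0, le_max_right _ _, ?_⟩
  rw [← Matrix.le_iff, ← Algebra.algebraMap_eq_smul_one]
  exact le_algebraMap_of_spectrum_le (fun x hx => (hc hx).trans (le_max_left _ _)) hA.isHermitian

end PosSemidef

section adjointMap

variable {n m : ℕ} {Φ : Matrix (Fin n) (Fin n) ℂ →ₗ[ℂ] Matrix (Fin m) (Fin m) ℂ}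

lemma Is2Positive.map_posSemidef (hΦ : Is2Positive Φ) {A : Matrix (Fin n) (Fin n) ℂ}
    (hA : A.PosSemidef) : (Φ A).PosSemidef := by
  have h : (fromBlocks A A A A).PosSemidef := by
    have := hA.mul_mul_conjTranspose_same 
      (fromRows (1 : Matrix (Fin n) (Fin n) ℂ) (1 : Matrix (Fin n) (Fin n) ℂ))
    convert this using 1
    ext (i | i) (j | j) <;> simp [conjTranspose_fromRows_eq_fromCols_conjTranspose, fromRows_mul]
  exact (hΦ _ _ _ _ h).submatrix Sum.inl

lemma Is2Positive.map_conjTranspose (hΦ : Is2Positive Φ) (B : Matrix (Fin n) (Fin n) ℂ) :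
    (Φ B)ᴴ = Φ Bᴴ := by
  have h : (fromBlocks (B * Bᴴ) B Bᴴ 1).PosSemidef := by
    have := posSemidef_self_mul_conjTranspose
      (fromBlocks B 0 1 0 : Matrix (Fin n ⊕ Fin n) (Fin n ⊕ Fin n) ℂ)
    simpa [fromBlocks_conjTranspose, fromBlocks_multiply] using this
  have := (hΦ _ _ _ _ h).isHermitian.eq
  rw [fromBlocks_conjTranspose, fromBlocks_inj] at this
  exact this.2.2.1

lemma trace_conjTranspose_mul_adjointMap (X : Matrix (Fin n) (Fin n) ℂ)
    (Y : Matrix (Fin m) (Fin m) ℂ) :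
    (Xᴴ * adjointMap Φ Y).trace = ((Φ X)ᴴ * Y).trace := by
  have hX : Φ X = ∑ i, ∑ j, X i j • Φ (single i j 1) := by
    conv_lhs => rw [matrix_eq_sum_single X]
    simp only [map_sum, ← map_smul, smul_single, smul_eq_mul, mul_one]
  rw [hX]
  simp only [conjTranspose_sum, conjTranspose_smul, Finset.sum_mul, trace_sum, smul_mul_assoc,
    trace_smul, smul_eq_mul]
  rw [Finset.sum_comm]
  simp [trace, mul_apply, adjointMap]

lemma adjointMap_sub (Y Z : Matrix (Fin m) (Fin m) ℂ) :
    adjointMap Φ (Y - Z) = adjointMap Φ Y - adjointMap Φ Z := by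
  ext i j
  simp [adjointMap, mul_sub]

lemma adjointMap_smul (c : ℝ) (Y : Matrix (Fin m) (Fin m) ℂ) :
    adjointMap Φ (c • Y) = c • adjointMap Φ Y := by
  ext i j
  simp [adjointMap]

lemma adjointMap_one (hΦtr : ∀ X, (Φ X).trace = X.trace) : adjointMap Φ 1 = 1 := by
  ext i j
  rcases eq_or_ne i j with rfl | h <;> simp [adjointMap, trace_conjTranspose, *]

lemma Is2Positive.adjointMap_posSemidef (hΦ : Is2Positive Φ) {Y : Matrix (Fin m) (Fin m) ℂ}
    (hY : Y.PosSemidef) : (adjointMap Φ Y).PosSemidef := by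
  refine .of_dotProduct_mulVec_nonneg ?_ fun x => ?_
  · ext i j
    rw [conjTranspose_apply, adjointMap, of_apply, of_apply, ← trace_conjTranspose,
      conjTranspose_mul, conjTranspose_conjTranspose, hY.isHermitian.eq, hΦ.map_conjTranspose,
      conjTranspose_single, star_one, trace_mul_comm]
  · have hx := posSemidef_vecMulVec_self_star x
    have h := trace_conjTranspose_mul_adjointMap (Φ := Φ) (vecMulVec x (star x)) Y
    rw [(hΦ.map_posSemidef hx).isHermitian.eq, hx.isHermitian.eq, vecMulVec_mul, trace_vecMulVec,
      dotProduct_comm, ← dotProduct_mulVec] at h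
    rw [h]
    exact (hΦ.map_posSemidef hx).trace_mul_nonneg hY

end adjointMap

section traceForm

variable {n m : ℕ}

lemma trace_mpow_sandwich_sq {A : Matrix (Fin n) (Fin n) ℂ} (hA : A.PosSemidef)
    (Y : Matrix (Fin n) (Fin n) ℂ) :
    ((mpow A (-(1/4)) * Y * mpow A (-(1/4))) ^ 2).trace
      = (mpow A (-(1/2)) * Y * mpow A (-(1/2)) * Y).trace := by
  have h : mpow A (-(1/2)) = mpow A (-(1/4)) * mpow A (-(1/4)) := by
    rw [mpow_mul_mpow hA]; norm_num
  rw [h, pow_two]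
  simp only [← mul_assoc]
  rw [trace_mul_comm]
  simp only [← mul_assoc]

lemma trace_form_comm (S Y Z : Matrix (Fin n) (Fin n) ℂ) :
    (S * Y * S * Z).trace = (S * Z * S * Y).trace := by
  rw [mul_assoc (S * Y), trace_mul_comm, ← mul_assoc]

lemma trace_form_sub_self (S Y Z : Matrix (Fin n) (Fin n) ℂ) :
    (S * (Y - Z) * S * (Y - Z)).trace
      = (S * Y * S * Y).trace - 2 * (S * Y * S * Z).trace + (S * Z * S * Z).trace := by
  simp only [mul_sub, sub_mul, trace_sub]
  rw [trace_form_comm S Z Y]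
  ring

lemma trace_form_eq {A D : Matrix (Fin n) (Fin n) ℂ} (hA : A.PosSemidef) (hD : D.IsHermitian) :
    (mpow A (-(1/2)) * D * mpow A (-(1/2)) * D).trace
      = ((mpow A (-(1/4)) * D * mpow A (-(1/4)))ᴴ
          * (mpow A (-(1/4)) * D * mpow A (-(1/4)))).trace := by
  rw [← trace_mpow_sandwich_sq hA, pow_two]
  simp only [conjTranspose_mul, mpow_isHermitian hA, hD.eq, mul_assoc]

lemma re_trace_form_convex {A Y Z : Matrix (Fin n) (Fin n) ℂ} (hA : A.PosSemidef)
    (hY : Y.IsHermitian) (hZ : Z.IsHermitian) :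
    2 * (mpow A (-(1/2)) * Y * mpow A (-(1/2)) * Z).trace.re
      ≤ (mpow A (-(1/2)) * Y * mpow A (-(1/2)) * Y).trace.re
        + (mpow A (-(1/2)) * Z * mpow A (-(1/2)) * Z).trace.re := by
  have h : 0 ≤ (mpow A (-(1/2)) * (Y - Z) * mpow A (-(1/2)) * (Y - Z)).trace := by
    rw [trace_form_eq hA (hY.sub hZ)]
    exact (posSemidef_conjTranspose_mul_self _).trace_nonneg
  rw [trace_form_sub_self] at h
  have := (Complex.le_def.mp h).1
  simp at this
  linarith

lemma eq_zero_of_trace_form_eq_zero {A D : Matrix (Fin n) (Fin n) ℂ} (hA : A.PosSemidef)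
    (hD : D.IsHermitian) (hsupp : D * mpow A 0 = D)
    (h : (mpow A (-(1/2)) * D * mpow A (-(1/2)) * D).trace.re = 0) : D = 0 := by
  rw [trace_form_eq hA hD] at h
  have h0 := (posSemidef_conjTranspose_mul_self
    (mpow A (-(1/4)) * D * mpow A (-(1/4)))).trace_nonneg
  have h1 := trace_conjTranspose_mul_self_eq_zero_iff.mp
    (Complex.ext h (Complex.le_def.mp h0).2.symm)
  calc D = mpow A 0 * D * mpow A 0 := by rw [mpow_zero_mul hA hD hsupp, hsupp]
    _ = mpow A (1/4) * (mpow A (-(1/4)) * D * mpow A (-(1/4))) * mpow A (1/4) := by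
      have e₁ : mpow A 0 = mpow A (1/4) * mpow A (-(1/4)) := by
        rw [mpow_mul_mpow hA]; norm_num
      have e₂ : mpow A 0 = mpow A (-(1/4)) * mpow A (1/4) := by
        rw [mpow_mul_mpow hA]; norm_num
      conv_lhs => rw [e₁]
      conv_lhs => enter [2]; rw [← e₁, e₂]
      simp only [mul_assoc]
    _ = 0 := by rw [h1, mul_zero, zero_mul]

end traceForm

section petzMap

variable {n m : ℕ} {Φ : Matrix (Fin n) (Fin n) ℂ →ₗ[ℂ] Matrix (Fin m) (Fin m) ℂ}
  {σ : Matrix (Fin n) (Fin n) ℂ}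

lemma petzMap_smul_sub (c : ℝ) (Y Z : Matrix (Fin m) (Fin m) ℂ) :
    petzMap Φ σ (c • Y - Z) = c • petzMap Φ σ Y - petzMap Φ σ Z := by
  simp only [petzMap, mul_sub, sub_mul, adjointMap_sub, mul_smul_comm, smul_mul_assoc,
    adjointMap_smul]

lemma petzMap_posSemidef (hΦ : Is2Positive Φ) (hσ : σ.PosSemidef) {Y : Matrix (Fin m) (Fin m) ℂ}
    (hY : Y.PosSemidef) : (petzMap Φ σ Y).PosSemidef := by
  have h := hY.mul_mul_conjTranspose_same (mpow (Φ σ) (-(1/2)))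
  rw [mpow_isHermitian (hΦ.map_posSemidef hσ)] at h
  have h' := (hΦ.adjointMap_posSemidef h).mul_mul_conjTranspose_same (mpow σ (1/2))
  rwa [mpow_isHermitian hσ] at h'

lemma petzMap_mul_mpow_zero (hσ : σ.PosSemidef) (Y : Matrix (Fin m) (Fin m) ℂ) :
    petzMap Φ σ Y * mpow σ 0 = petzMap Φ σ Y := by
  rw [petzMap, mul_assoc, mpow_mul_mpow hσ, add_zero]

lemma sub_petzMap_map_self_posSemidef (hΦ : Is2Positive Φ) (hΦtr : ∀ X, (Φ X).trace = X.trace)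
    (hσ : σ.PosSemidef) : (σ - petzMap Φ σ (Φ σ)).PosSemidef := by
  have hΦσ := hΦ.map_posSemidef hσ
  have e₁ : mpow (Φ σ) (-(1/2)) * Φ σ * mpow (Φ σ) (-(1/2)) = mpow (Φ σ) 0 := by
    conv_lhs => enter [1, 2]; rw [← mpow_one hΦσ]
    rw [mpow_mul_mpow hΦσ, mpow_mul_mpow hΦσ]; norm_num
  have e₂ : σ = mpow σ (1/2) * 1 * mpow σ (1/2) := by
    rw [mul_one, mpow_mul_mpow hσ, add_halves, mpow_one hσ]
  have h := (hΦ.adjointMap_posSemidef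
    (one_sub_mpow_zero_posSemidef (Φ σ))).mul_mul_conjTranspose_same (mpow σ (1/2))
  rw [mpow_isHermitian hσ, adjointMap_sub, adjointMap_one hΦtr, mul_sub, sub_mul, ← e₂] at h
  rwa [petzMap, e₁]

lemma trace_form_petzMap (hΦ : Is2Positive Φ) (hσ : σ.PosSemidef)
    {Y : Matrix (Fin n) (Fin n) ℂ} (hY : Y.IsHermitian) (hYσ : Y * mpow σ 0 = Y)
    (Z : Matrix (Fin m) (Fin m) ℂ) :
    (mpow σ (-(1/2)) * Y * mpow σ (-(1/2)) * petzMap Φ σ Z).trace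
      = (mpow (Φ σ) (-(1/2)) * Φ Y * mpow (Φ σ) (-(1/2)) * Z).trace := by
  have e₁ : mpow σ (-(1/2)) * mpow σ (1/2) = mpow σ 0 := by
    rw [mpow_mul_mpow hσ]; norm_num
  have e₂ : mpow σ (1/2) * mpow σ (-(1/2)) = mpow σ 0 := by
    rw [mpow_mul_mpow hσ]; norm_num
  set W := adjointMap Φ (mpow (Φ σ) (-(1/2)) * Z * mpow (Φ σ) (-(1/2))) with hW
  calc _ = (mpow σ (-(1/2)) * (Y * (mpow σ (-(1/2)) * mpow σ (1/2)) * W * mpow σ (1/2))).trace := by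
        rw [petzMap, ← hW]
        simp only [mul_assoc]
    _ = (mpow σ (1/2) * mpow σ (-(1/2)) * Y * W).trace := by
        rw [e₁, hYσ, ← mul_assoc, trace_mul_comm]
        simp only [mul_assoc]
    _ = (Yᴴ * W).trace := by rw [e₂, mpow_zero_mul hσ hY hYσ, hY.eq]
    _ = (Φ Y * (mpow (Φ σ) (-(1/2)) * Z * mpow (Φ σ) (-(1/2)))).trace := by
        rw [hW, trace_conjTranspose_mul_adjointMap, hΦ.map_conjTranspose, hY.eq]
    _ = _ := by
        rw [← mul_assoc, trace_mul_comm]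
        simp only [mul_assoc]

end petzMap

/-- If the interleaved sequence `e 0, f 0, e 1, f 1, …` is convex and `e` is bounded above,
then `e 1 ≤ f 0`. -/
lemma le_of_interleaved_convex_of_bounded {e f : ℕ → ℝ} {C : ℝ} (he : ∀ j, e j ≤ C)
    (h₁ : ∀ j, 2 * f j ≤ e j + e (j + 1)) (h₂ : ∀ j, 2 * e (j + 1) ≤ f j + f (j + 1)) :
    e 1 ≤ f 0 := by
  by_contra! h
  have key (j : ℕ) : e 1 - f 0 ≤ e (j + 1) - f j ∧ e 1 + j * (e 1 - f 0) ≤ e (j + 1) := by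
    induction j with
    | zero => simp
    | succ j ih =>
      have := h₁ (j + 1)
      have := h₂ j
      push_cast
      constructor <;> linarith
  obtain ⟨j, hj⟩ := exists_nat_gt ((C - e 1) / (e 1 - f 0))
  rw [div_lt_iff₀ (sub_pos.mpr h)] at hj
  linarith [(key j).2, he (j + 1)]

lemma exists_smul_sub_posSemidef {n : ℕ} {ρ σ : Matrix (Fin n) (Fin n) ℂ} (hρ : ρ.PosSemidef)
    (hσ : σ.PosSemidef) (hsupp : ρ * mpow σ 0 = ρ) :
    ∃ c : ℝ, 0 ≤ c ∧ (c • σ - ρ).PosSemidef := by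
  have h := hρ.mul_mul_conjTranspose_same (mpow σ (-(1/2)))
  rw [mpow_isHermitian hσ] at h
  obtain ⟨c, hc, hcp⟩ := h.exists_smul_one_sub
  refine ⟨c, hc, ?_⟩
  have h' := hcp.mul_mul_conjTranspose_same (mpow σ (1/2))
  have e₀ : mpow σ (1/2) * mpow σ (1/2) = σ := by
    rw [mpow_mul_mpow hσ, add_halves, mpow_one hσ]
  have e₁ : mpow σ (-(1/2)) * mpow σ (1/2) = mpow σ 0 := by
    rw [mpow_mul_mpow hσ]; norm_num
  have e₂ : mpow σ (1/2) * mpow σ (-(1/2)) = mpow σ 0 := by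
    rw [mpow_mul_mpow hσ]; norm_num
  have e₃ : mpow σ (1/2) * (mpow σ (-(1/2)) * ρ * mpow σ (-(1/2))) * mpow σ (1/2) = ρ := by
    rw [← mul_assoc, ← mul_assoc, e₂, mul_assoc, e₁, mpow_zero_mul hσ hρ.isHermitian hsupp, hsupp]
  rwa [mpow_isHermitian hσ, mul_sub, sub_mul, e₃, mul_smul_comm, mul_one, smul_mul_assoc,
    e₀] at h'

/-- for `ρ, σ` positive semidefinite with `supp ρ ⊆ supp σ` and a 2-positive
trace-preserving `Φ`, the sandwiched Rényi divergence `D₂*` is preserved by `Φ`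
(`Tr((Φσ^{-1/4} Φρ Φσ^{-1/4})²) = Tr((σ^{-1/4} ρ σ^{-1/4})²)`) if and only if the Petz
recovery map recovers `ρ` from `Φ(ρ)`. -/
theorem stmt9 {n m : ℕ} (ρ σ : Matrix (Fin n) (Fin n) ℂ)
    (hρ : ρ.PosSemidef) (hσ : σ.PosSemidef)
    (hsupp : ∀ v : Fin n → ℂ, σ *ᵥ v = 0 → ρ *ᵥ v = 0)
    (Φ : Matrix (Fin n) (Fin n) ℂ →ₗ[ℂ] Matrix (Fin m) (Fin m) ℂ)
    (hΦ2 : Is2Positive Φ) (hΦtr : ∀ X, (Φ X).trace = X.trace) :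
    Matrix.trace ((mpow (Φ σ) (-(1/4)) * Φ ρ * mpow (Φ σ) (-(1/4))) ^ 2)
        = Matrix.trace ((mpow σ (-(1/4)) * ρ * mpow σ (-(1/4))) ^ 2)
      ↔ petzMap Φ σ (Φ ρ) = ρ := by
  have hρσ : ρ * mpow σ 0 = ρ := mul_mpow_zero hσ hsupp
  have hΦσ := hΦ2.map_posSemidef hσ
  rw [trace_mpow_sandwich_sq hΦσ, trace_mpow_sandwich_sq hσ,
    ← trace_form_petzMap hΦ2 hσ hρ.isHermitian hρσ]
  refine ⟨fun h => ?_, fun h => by rw [h]⟩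
  obtain ⟨c, hc, hcρ⟩ := exists_smul_sub_posSemidef hρ hσ hρσ
  set r : ℕ → Matrix (Fin n) (Fin n) ℂ := fun j => (fun Y => petzMap Φ σ (Φ Y))^[j] ρ
  have hr_succ (j : ℕ) : r (j + 1) = petzMap Φ σ (Φ (r j)) := Function.iterate_succ_apply' _ _ _
  have hr_prop (j : ℕ) :
      (r j).PosSemidef ∧ r j * mpow σ 0 = r j ∧ (c • σ - r j).PosSemidef := by
    induction j with
    | zero => exact ⟨hρ, hρσ, hcρ⟩
    | succ j ih =>
      obtain ⟨h₁, -, h₃⟩ := ih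
      rw [hr_succ]
      refine ⟨petzMap_posSemidef hΦ2 hσ (hΦ2.map_posSemidef h₁), petzMap_mul_mpow_zero hσ _, ?_⟩
      have := ((sub_petzMap_map_self_posSemidef hΦ2 hΦtr hσ).smul hc).add
        (petzMap_posSemidef hΦ2 hσ (hΦ2.map_posSemidef h₃))
      rwa [map_sub, LinearMap.map_smul_of_tower, petzMap_smul_sub, smul_sub,
        sub_add_sub_cancel] at this
  have hherm (j : ℕ) := (hr_prop j).1.isHermitian
  have hΦherm (j : ℕ) := (hΦ2.map_posSemidef (hr_prop j).1).isHermitian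
  have hshift (i j : ℕ) := hr_succ j ▸ trace_form_petzMap hΦ2 hσ (hherm i) (hr_prop i).2.1 (Φ (r j))
  have hmono {Y : Matrix (Fin n) (Fin n) ℂ} (hY : Y.PosSemidef) (j : ℕ) :
      (mpow σ (-(1/2)) * Y * mpow σ (-(1/2)) * r j).trace.re
        ≤ c * (mpow σ (-(1/2)) * Y * mpow σ (-(1/2)) * σ).trace.re := by
    have hS := hY.mul_mul_conjTranspose_same (mpow σ (-(1/2)))
    rw [mpow_isHermitian hσ] at hS
    have := (Complex.le_def.mp (hS.trace_mul_nonneg (hr_prop j).2.2)).1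
    rw [mul_sub, trace_sub, mul_smul_comm, trace_smul] at this
    simpa using this
  have hle := le_of_interleaved_convex_of_bounded
    (e := fun j => (mpow σ (-(1/2)) * r j * mpow σ (-(1/2)) * r j).trace.re)
    (f := fun j => (mpow σ (-(1/2)) * r j * mpow σ (-(1/2)) * r (j + 1)).trace.re)
    (C := c * (c * (mpow σ (-(1/2)) * σ * mpow σ (-(1/2)) * σ).trace.re))
    (fun j => (hmono (hr_prop j).1 j).trans <| mul_le_mul_of_nonneg_left
      (by rw [trace_form_comm]; exact hmono hσ j) hc)
    (fun j => re_trace_form_convex hσ (hherm j) (hherm (j + 1)))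
    (fun j => by
      rw [hshift j j, hshift (j + 1) j, hshift (j + 1) (j + 1), trace_form_comm]
      exact re_trace_form_convex hΦσ (hΦherm j) (hΦherm (j + 1)))
  have h01 : r 1 = petzMap Φ σ (Φ ρ) := rfl
  have h00 : r 0 = ρ := rfl
  simp only [zero_add] at hle
  rw [← h01, ← h00] at h ⊢
  have hconv := re_trace_form_convex hσ (hherm 0) (hherm 1)
  have h' := congrArg Complex.re h
  refine sub_eq_zero.mp (eq_zero_of_trace_form_eq_zero hσ ((hherm 1).sub (hherm 0)) ?_ ?_)
  · rw [sub_mul, (hr_prop 1).2.1, (hr_prop 0).2.1]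
  · rw [trace_form_sub_self, trace_form_comm _ (r 1) (r 0)]
    simp
    simp at h' hle hconv
    linarith
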